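/- arXiv:1812.02094 — 4 statements merged into one kernel-verified Lean document; each statement's English description precedes it below -/
import Mathlib

section
/- Let Ubar ∈ ℝ^{N×n} have orthonormal columns, let Ftilde ∈ ℝ^{n×w} have rank n (so w ≥ n), and set F = Ubar·Ftilde. Let Uhat ∈ ℝ^{N×n} have orthonormal columns. Then ‖F − Uhat Uhatᵀ F‖_F² ≥ σ_min(Ftilde)² · ‖Ubar − Uhat Uhatᵀ Ubar‖_F², where σ_min(Ftilde) > 0 is the smallest singular value of Ftilde; moreover σ_min(Ftilde) equals the smallest nonzero singular value of F. -/
open Matrix Finset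

/-- Squared Frobenius norm of a real matrix. -/
noncomputable def frobSq {m k : ℕ} (A : Matrix (Fin m) (Fin k) ℝ) : ℝ :=
  ∑ i, ∑ j, A i j ^ 2

/-- `σ : Fin r → ℝ` is the (decreasingly sorted) list of nonzero singular values of `M`,
expressed through a compact singular value decomposition `M = ∑ i, σ i • u i (v i)ᵀ`
with orthonormal families `u` and `v` and positive decreasing `σ`.  In particular
this forces `M` to have rank `r`. -/
def IsSingularValues {m k : ℕ} (M : Matrix (Fin m) (Fin k) ℝ) (r : ℕ) (σ : Fin r → ℝ) : Prop :=
  (∀ i, 0 < σ i) ∧ Antitone σ ∧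
  ∃ (u : Fin r → Fin m → ℝ) (v : Fin r → Fin k → ℝ),
    (∀ i j, u i ⬝ᵥ u j = if i = j then (1 : ℝ) else 0) ∧
    (∀ i j, v i ⬝ᵥ v j = if i = j then (1 : ℝ) else 0) ∧
    M = ∑ i, σ i • Matrix.vecMulVec (u i) (v i)

theorem frobSq_eq_trace {m k : ℕ} (A : Matrix (Fin m) (Fin k) ℝ) :
    frobSq A = (A * Aᵀ).trace := by
  simp [frobSq, Matrix.trace, Matrix.mul_apply, sq]

/-- Right multiplication by a matrix with orthonormal rows preserves the Frobenius norm. -/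
theorem frobSq_mul_of_mul_transpose_eq_one {m k l : ℕ} (A : Matrix (Fin m) (Fin k) ℝ)
    {Q : Matrix (Fin k) (Fin l) ℝ} (hQ : Q * Qᵀ = 1) : frobSq (A * Q) = frobSq A := by
  rw [frobSq_eq_trace, frobSq_eq_trace, Matrix.transpose_mul, Matrix.mul_assoc,
    ← Matrix.mul_assoc Q, hQ, Matrix.one_mul]

theorem sq_mul_frobSq_le_frobSq_mul_diagonal {m k : ℕ} (A : Matrix (Fin m) (Fin k) ℝ)
    {d : Fin k → ℝ} {c : ℝ} (hc : 0 ≤ c) (hd : ∀ i, c ≤ d i) :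
    c ^ 2 * frobSq A ≤ frobSq (A * Matrix.diagonal d) := by
  simp only [frobSq, Finset.mul_sum, Matrix.mul_diagonal, mul_pow]
  refine Finset.sum_le_sum fun i _ => Finset.sum_le_sum fun j _ => ?_
  rw [mul_comm]
  gcongr
  exact hd j

theorem sum_smul_vecMulVec_eq {m k r : ℕ} (σ : Fin r → ℝ) (u : Fin r → Fin m → ℝ)
    (v : Fin r → Fin k → ℝ) :
    ∑ i, σ i • Matrix.vecMulVec (u i) (v i) =
      (Matrix.of u)ᵀ * Matrix.diagonal σ * Matrix.of v := by
  ext a b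
  rw [Matrix.mul_apply, Matrix.sum_apply]
  simp only [Matrix.smul_apply, Matrix.vecMulVec_apply, smul_eq_mul, Matrix.mul_diagonal,
    Matrix.transpose_apply, Matrix.of_apply]
  exact Finset.sum_congr rfl fun i _ => by ring

theorem of_mul_transpose_eq_one {m r : ℕ} {u : Fin r → Fin m → ℝ}
    (hu : ∀ i j, u i ⬝ᵥ u j = if i = j then (1 : ℝ) else 0) :
    Matrix.of u * (Matrix.of u)ᵀ = 1 := by
  ext i j
  rw [Matrix.one_apply, ← hu i j]
  rfl

/-- For `M` of full row rank, right multiplication by `M` scales the Frobenius norm by at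
least any lower bound of the singular values. -/
theorem IsSingularValues.sq_mul_frobSq_le {m n w : ℕ} {M : Matrix (Fin n) (Fin w) ℝ}
    {σ : Fin n → ℝ} (hσ : IsSingularValues M n σ) (A : Matrix (Fin m) (Fin n) ℝ) {c : ℝ}
    (hc : 0 ≤ c) (hcσ : ∀ i, c ≤ σ i) : c ^ 2 * frobSq A ≤ frobSq (A * M) := by
  obtain ⟨-, -, u, v, hu, hv, rfl⟩ := hσ
  have hP : (Matrix.of u)ᵀ * (Matrix.of u)ᵀᵀ = 1 := by
    rw [Matrix.transpose_transpose]
    exact mul_eq_one_comm.mp (of_mul_transpose_eq_one hu)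
  rw [sum_smul_vecMulVec_eq, ← Matrix.mul_assoc,
    frobSq_mul_of_mul_transpose_eq_one _ (of_mul_transpose_eq_one hv), ← Matrix.mul_assoc,
    ← frobSq_mul_of_mul_transpose_eq_one A hP]
  exact sq_mul_frobSq_le_frobSq_mul_diagonal _ hc hcσ

/-- Left multiplication by a matrix with orthonormal columns preserves the singular values. -/
theorem IsSingularValues.mul_left {N m k r : ℕ} {M : Matrix (Fin m) (Fin k) ℝ} {σ : Fin r → ℝ}
    (hσ : IsSingularValues M r σ) {U : Matrix (Fin N) (Fin m) ℝ} (hU : Uᵀ * U = 1) :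
    IsSingularValues (U * M) r σ := by
  obtain ⟨hpos, hanti, u, v, hu, hv, rfl⟩ := hσ
  refine ⟨hpos, hanti, fun i => U *ᵥ u i, v, fun i j => ?_, hv, ?_⟩
  · rw [Matrix.dotProduct_mulVec, Matrix.vecMul_mulVec, hU, Matrix.vecMul_one, hu]
  · simp only [Matrix.mul_sum, Matrix.mul_smul, Matrix.mul_vecMulVec]

/-- Let `Ubar ∈ ℝ^{N×n}` have orthonormal columns, let `Ftilde ∈ ℝ^{n×w}` have rank `n`
(with nonzero singular values `σ`), and set `F = Ubar·Ftilde`.  For any `Uhat ∈ ℝ^{N×n}`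
with orthonormal columns,
`‖F − Uhat Uhatᵀ F‖_F² ≥ σ_min(Ftilde)² ‖Ubar − Uhat Uhatᵀ Ubar‖_F²`,
and moreover `σ_min(Ftilde)` equals the smallest nonzero singular value of `F`. -/
theorem projection_error_lower_bound_via_sigma_min
    {N n w : ℕ} (hn : 0 < n)
    (Ubar : Matrix (Fin N) (Fin n) ℝ) (hUbar : Ubarᵀ * Ubar = 1)
    (Ftilde : Matrix (Fin n) (Fin w) ℝ) (σ : Fin n → ℝ)
    (hσ : IsSingularValues Ftilde n σ)
    (Uhat : Matrix (Fin N) (Fin n) ℝ) (hUhat : Uhatᵀ * Uhat = 1) :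
    (0 < σ ⟨n - 1, Nat.sub_lt hn one_pos⟩ ∧
      σ ⟨n - 1, Nat.sub_lt hn one_pos⟩ ^ 2 * frobSq (Ubar - Uhat * Uhatᵀ * Ubar) ≤
        frobSq (Ubar * Ftilde - Uhat * Uhatᵀ * (Ubar * Ftilde))) ∧
    ∃ σF : Fin n → ℝ, IsSingularValues (Ubar * Ftilde) n σF ∧
      σF ⟨n - 1, Nat.sub_lt hn one_pos⟩ = σ ⟨n - 1, Nat.sub_lt hn one_pos⟩ := by
  have hpos := hσ.1 ⟨n - 1, Nat.sub_lt hn one_pos⟩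
  refine ⟨⟨hpos, ?_⟩, σ, hσ.mul_left hUbar, rfl⟩
  rw [← Matrix.mul_assoc (Uhat * Uhatᵀ), ← Matrix.sub_mul]
  exact hσ.sq_mul_frobSq_le _ hpos.le fun i => hσ.2.1 (Fin.le_def.mpr (Nat.le_pred_of_lt i.isLt))
end

section
/- Let U, Ubar ∈ ℝ^{N×n} have orthonormal columns and define the local coherence γ_i(V) = (N/n)·‖Vᵀe_i‖₂² for i = 1,…,N. Suppose there is a bijection j of {1,…,N} and constants c_4, cbar_4, c_5, cbar_5 > 0 and a, abar > 1 such that γ_{j(i)}(U) ≤ c_4·exp(−c_5·i^a) and γ_{j(i)}(Ubar) ≤ cbar_4·exp(−cbar_5·i^{abar}) for all i. Let F = Ubar·Ftilde for some Ftilde ∈ ℝ^{n×w}, let P be an interpolation points matrix with PᵀU invertible, set C = (PᵀU)^{-1}PᵀF, R = UC − F, and Λ = ‖(PᵀU)^{-1}‖₂. Then for all i = 1,…,N, ‖Rᵀe_{j(i)}‖₂² ≤ c_7·(n/N)·‖F‖₂²·exp(−min{c_5, cbar_5}·i^{min{a, abar}}), where c_7 = (√(cbar_4) + Λ·√(c_4))².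 -/
open Matrix Finset

/-- Squared Euclidean norm of the `i`-th row of `A`, i.e. `‖Aᵀ e_i‖₂²`. -/
noncomputable def rowNormSq {m k : ℕ} (A : Matrix (Fin m) (Fin k) ℝ) (i : Fin m) : ℝ :=
  ∑ j, A i j ^ 2

/-- The matrix `[e_{s 0}, …, e_{s (m-1)}] ∈ ℝ^{N×m}` whose columns are the canonical
unit vectors of `ℝ^N` selected by `s`. -/
noncomputable def samplingMatrix {N m : ℕ} (s : Fin m → Fin N) : Matrix (Fin N) (Fin m) ℝ :=
  Matrix.of fun i k => if i = s k then 1 else 0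

/-- Spectral norm (operator 2-norm) of a real matrix. -/
noncomputable def specNorm {m k : ℕ} (A : Matrix (Fin m) (Fin k) ℝ) : ℝ :=
  ‖LinearMap.toContinuousLinearMap (Matrix.toEuclideanLin A)‖

section SpectralNorm

open scoped Matrix.Norms.L2Operator

theorem specNorm_eq_norm {m k : ℕ} (A : Matrix (Fin m) (Fin k) ℝ) : specNorm A = ‖A‖ := rfl

theorem specNorm_nonneg {m k : ℕ} (A : Matrix (Fin m) (Fin k) ℝ) : 0 ≤ specNorm A :=
  norm_nonneg _

theorem specNorm_mul_le {m k l : ℕ} (A : Matrix (Fin m) (Fin k) ℝ)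
    (B : Matrix (Fin k) (Fin l) ℝ) : specNorm (A * B) ≤ specNorm A * specNorm B := by
  simpa only [specNorm_eq_norm] using Matrix.l2_opNorm_mul A B

theorem specNorm_transpose {m k : ℕ} (A : Matrix (Fin m) (Fin k) ℝ) :
    specNorm Aᵀ = specNorm A := by
  rw [specNorm_eq_norm, specNorm_eq_norm, ← Matrix.conjTranspose_eq_transpose_of_trivial,
    Matrix.l2_opNorm_conjTranspose]

theorem specNorm_le_one_of_transpose_mul_self {m k : ℕ} {A : Matrix (Fin m) (Fin k) ℝ}
    (hA : Aᵀ * A = 1) : specNorm A ≤ 1 := by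
  have h := Matrix.l2_opNorm_conjTranspose_mul_self A
  rw [Matrix.conjTranspose_eq_transpose_of_trivial, hA] at h
  have h1 : ‖(1 : Matrix (Fin k) (Fin k) ℝ)‖ ≤ 1 := by
    rcases subsingleton_or_nontrivial (Matrix (Fin k) (Fin k) ℝ) with _ | _
    · rw [Subsingleton.elim (1 : Matrix (Fin k) (Fin k) ℝ) 0, norm_zero]
      exact zero_le_one
    · exact CStarRing.norm_one.le
  rw [specNorm_eq_norm]
  nlinarith [norm_nonneg A]

theorem sqrt_rowNormSq {m k : ℕ} (A : Matrix (Fin m) (Fin k) ℝ) (i : Fin m) :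
    Real.sqrt (rowNormSq A i) = ‖WithLp.toLp 2 (A i)‖ := by
  simp [EuclideanSpace.norm_eq, rowNormSq]

theorem sqrt_rowNormSq_mul_le {m k l : ℕ} (A : Matrix (Fin m) (Fin k) ℝ)
    (B : Matrix (Fin k) (Fin l) ℝ) (i : Fin m) :
    Real.sqrt (rowNormSq (A * B) i) ≤ specNorm B * Real.sqrt (rowNormSq A i) := by
  have h := Matrix.l2_opNorm_mulVec Bᵀ (WithLp.toLp 2 (A i))
  rw [sqrt_rowNormSq, sqrt_rowNormSq, ← specNorm_transpose, specNorm_eq_norm]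
  convert h using 3
  rw [Matrix.mulVec_transpose]
  rfl

theorem sqrt_rowNormSq_sub_le {m k : ℕ} (A B : Matrix (Fin m) (Fin k) ℝ) (i : Fin m) :
    Real.sqrt (rowNormSq (A - B) i) ≤
      Real.sqrt (rowNormSq A i) + Real.sqrt (rowNormSq B i) := by
  simp only [sqrt_rowNormSq]
  exact norm_sub_le (WithLp.toLp 2 (A i)) (WithLp.toLp 2 (B i))

end SpectralNorm

theorem rowNormSq_nonneg {m k : ℕ} (A : Matrix (Fin m) (Fin k) ℝ) (i : Fin m) :
    0 ≤ rowNormSq A i :=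
  Finset.sum_nonneg fun _ _ => sq_nonneg _

theorem samplingMatrix_transpose_mul_self {N m : ℕ} {s : Fin m → Fin N}
    (hs : Function.Injective s) : (samplingMatrix s)ᵀ * samplingMatrix s = 1 := by
  ext k l
  simp [samplingMatrix, Matrix.mul_apply, Matrix.one_apply, hs.eq_iff, eq_comm]

/-- Weakening both the rate and the exponent of a superexponential decay. -/
theorem exp_neg_mul_rpow_le {c c' a a' x : ℝ} (hc' : 0 ≤ c') (hc : c' ≤ c) (ha : a' ≤ a)
    (hx : 1 ≤ x) : Real.exp (-c * x ^ a) ≤ Real.exp (-c' * x ^ a') := by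
  have h : c' * x ^ a' ≤ c * x ^ a :=
    mul_le_mul hc (Real.rpow_le_rpow_of_exponent_le hx ha) (by positivity) (hc'.trans hc)
  exact Real.exp_le_exp.2 (by linarith)

theorem sqrt_le_of_coherence_le {N n r c E E' : ℝ} (hN : 0 < N) (hn : 0 < n) (hc : 0 ≤ c)
    (h : N / n * r ≤ c * E) (hE : E ≤ E') :
    Real.sqrt r ≤ Real.sqrt c * Real.sqrt (n / N * E') := by
  rw [← Real.sqrt_mul hc]
  apply Real.sqrt_le_sqrt
  calc r = n / N * (N / n * r) := by field_simp
    _ ≤ n / N * (c * E') :=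
        mul_le_mul_of_nonneg_left (h.trans (mul_le_mul_of_nonneg_left hE hc)) (by positivity)
    _ = c * (n / N * E') := by ring

/-- (Lemma 3.4.)  If the local coherences `γ_i(V) = (N/n)‖Vᵀe_i‖₂²` of the spaces spanned
by `U` and `Ubar` decay exponentially along a bijection `j`, then the component-wise DEIM
residual of `F = Ubar·Ftilde`, namely `R = UC − F` with `C = (PᵀU)⁻¹PᵀF`, satisfies
`‖Rᵀe_{j(i)}‖₂² ≤ c₇·(n/N)·‖F‖₂²·exp(−min{c₅,c̄₅}·i^{min{a,ā}})` with
`c₇ = (√c̄₄ + Λ·√c₄)²` and `Λ = ‖(PᵀU)⁻¹‖₂`. -/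
theorem local_coherence_residual_decay
    {N n w : ℕ} (hN : 0 < N) (hn : 0 < n)
    (U Ubar : Matrix (Fin N) (Fin n) ℝ)
    (hU : Uᵀ * U = 1) (hUbar : Ubarᵀ * Ubar = 1)
    (j : Equiv.Perm (Fin N)) (c₄ cbar₄ c₅ cbar₅ a abar : ℝ)
    (hc₄ : 0 < c₄) (hcbar₄ : 0 < cbar₄) (hc₅ : 0 < c₅) (hcbar₅ : 0 < cbar₅)
    (ha : 1 < a) (habar : 1 < abar)
    (hcoh : ∀ i : Fin N, (N : ℝ) / n * rowNormSq U (j i) ≤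
      c₄ * Real.exp (-c₅ * (((i : ℕ) + 1 : ℕ) : ℝ) ^ a))
    (hcohbar : ∀ i : Fin N, (N : ℝ) / n * rowNormSq Ubar (j i) ≤
      cbar₄ * Real.exp (-cbar₅ * (((i : ℕ) + 1 : ℕ) : ℝ) ^ abar))
    (Ftilde : Matrix (Fin n) (Fin w) ℝ)
    (F : Matrix (Fin N) (Fin w) ℝ) (hF : F = Ubar * Ftilde)
    (p : Fin n → Fin N) (hp : Function.Injective p)
    (hPU : IsUnit ((samplingMatrix p)ᵀ * U))
    (C : Matrix (Fin n) (Fin w) ℝ)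
    (hC : C = ((samplingMatrix p)ᵀ * U)⁻¹ * ((samplingMatrix p)ᵀ * F))
    (R : Matrix (Fin N) (Fin w) ℝ) (hR : R = U * C - F) :
    ∀ i : Fin N, rowNormSq R (j i) ≤
      (Real.sqrt cbar₄ + specNorm (((samplingMatrix p)ᵀ * U)⁻¹) * Real.sqrt c₄) ^ 2 *
        ((n : ℝ) / N) * specNorm F ^ 2 *
        Real.exp (-min c₅ cbar₅ * (((i : ℕ) + 1 : ℕ) : ℝ) ^ min a abar) := by
  intro i
  have hNr : (0 : ℝ) < N := by exact_mod_cast hN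
  have hnr : (0 : ℝ) < n := by exact_mod_cast hn
  have hx : (1 : ℝ) ≤ (((i : ℕ) + 1 : ℕ) : ℝ) := by exact_mod_cast Nat.le_add_left 1 i
  have hmin : 0 ≤ min c₅ cbar₅ := (lt_min hc₅ hcbar₅).le
  set E := Real.exp (-min c₅ cbar₅ * (((i : ℕ) + 1 : ℕ) : ℝ) ^ min a abar)
  set Λ := specNorm (((samplingMatrix p)ᵀ * U)⁻¹)
  set q := Real.sqrt ((n : ℝ) / N * E)
  have hUi : Real.sqrt (rowNormSq U (j i)) ≤ Real.sqrt c₄ * q :=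
    sqrt_le_of_coherence_le hNr hnr hc₄.le (hcoh i)
      (exp_neg_mul_rpow_le hmin (min_le_left _ _) (min_le_left _ _) hx)
  have hUbari : Real.sqrt (rowNormSq Ubar (j i)) ≤ Real.sqrt cbar₄ * q :=
    sqrt_le_of_coherence_le hNr hnr hcbar₄.le (hcohbar i)
      (exp_neg_mul_rpow_le hmin (min_le_right _ _) (min_le_right _ _) hx)
  have hΛ : 0 ≤ Λ := specNorm_nonneg _
  have hFnn : 0 ≤ specNorm F := specNorm_nonneg F
  have hFtilde : specNorm Ftilde ≤ specNorm F := by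
    have h : Ftilde = Ubarᵀ * F := by rw [hF, ← Matrix.mul_assoc, hUbar, Matrix.one_mul]
    calc specNorm Ftilde = specNorm (Ubarᵀ * F) := by rw [← h]
      _ ≤ specNorm Ubarᵀ * specNorm F := specNorm_mul_le _ _
      _ ≤ specNorm F := mul_le_of_le_one_left hFnn
        (specNorm_transpose Ubar ▸ specNorm_le_one_of_transpose_mul_self hUbar)
  have hCnorm : specNorm C ≤ Λ * specNorm F := by
    rw [hC]
    refine (specNorm_mul_le _ _).trans (mul_le_mul_of_nonneg_left ?_ hΛ)
    exact (specNorm_mul_le _ _).trans (mul_le_of_le_one_left hFnn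
      (specNorm_transpose (samplingMatrix p) ▸
        specNorm_le_one_of_transpose_mul_self (samplingMatrix_transpose_mul_self hp)))
  have key : Real.sqrt (rowNormSq R (j i)) ≤
      (Real.sqrt cbar₄ + Λ * Real.sqrt c₄) * specNorm F * q :=
    calc Real.sqrt (rowNormSq R (j i))
        ≤ Real.sqrt (rowNormSq (U * C) (j i)) + Real.sqrt (rowNormSq F (j i)) :=
          hR ▸ sqrt_rowNormSq_sub_le _ _ _
      _ ≤ specNorm C * Real.sqrt (rowNormSq U (j i)) +
            specNorm Ftilde * Real.sqrt (rowNormSq Ubar (j i)) :=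
          add_le_add (sqrt_rowNormSq_mul_le _ _ _)
            ((congrArg (fun M => Real.sqrt (rowNormSq M (j i))) hF).trans_le
              (sqrt_rowNormSq_mul_le _ _ _))
      _ ≤ Λ * specNorm F * (Real.sqrt c₄ * q) + specNorm F * (Real.sqrt cbar₄ * q) := by
          gcongr
      _ = (Real.sqrt cbar₄ + Λ * Real.sqrt c₄) * specNorm F * q := by ring
  have hq : q ^ 2 = (n : ℝ) / N * E := Real.sq_sqrt (by positivity)
  calc rowNormSq R (j i) = Real.sqrt (rowNormSq R (j i)) ^ 2 :=
        (Real.sq_sqrt (rowNormSq_nonneg _ _)).symm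
    _ ≤ ((Real.sqrt cbar₄ + Λ * Real.sqrt c₄) * specNorm F * q) ^ 2 :=
        pow_le_pow_left₀ (Real.sqrt_nonneg _) key 2
    _ = (Real.sqrt cbar₄ + Λ * Real.sqrt c₄) ^ 2 * specNorm F ^ 2 * q ^ 2 := by ring
    _ = _ := by rw [hq]; ring
end

section
/- For s ∈ [0, 1], let q_s ∈ L²((−5, 5)) denote the indicator function of the interval (s, 5). Let n ≥ 1 and 0 < t_1 < t_2 < … < t_n ≤ 1, and let 𝒰 ⊂ L²((−5, 5)) be the linear span of q_{t_1}, …, q_{t_n}. Then the L²-distance of q_t to 𝒰 satisfies: for t ∈ [0, t_1), inf_{q* ∈ 𝒰} ‖q_t − q*‖_{L²(−5,5)} = √(t_1 − t), and for t ∈ [t_i, t_{i+1}] with 1 ≤ i ≤ n−1, inf_{q* ∈ 𝒰} ‖q_t − q*‖_{L²(−5,5)} = √((t_{i+1} − t)(t − t_i)/(t_{i+1} − t_i)). -/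
open MeasureTheory

/-- The indicator function of the interval `(s, 5)` as an element of `L²((−5,5))`
(the Lebesgue space over `(−5,5)`), i.e. the solution `q(·, s)` of the advection
equation with step initial condition. -/
noncomputable def qfun (s : ℝ) :
    Lp ℝ 2 ((volume : Measure ℝ).restrict (Set.Ioo (-5 : ℝ) 5)) :=
  indicatorConstLp 2 (measurableSet_Ioo : MeasurableSet (Set.Ioo s 5))
    (ne_top_of_le_ne_top (by simp [Real.volume_Ioo]) (Measure.restrict_apply_le _ _))
    (1 : ℝ)

/-- If `p ∈ span S` and `x - p` is orthogonal to `S`, then the distance from `x` to `span S`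
is `‖x - p‖ = √⟪x - p, x⟫`. -/
theorem infDist_span_eq_sqrt_inner {E : Type*} [NormedAddCommGroup E] [InnerProductSpace ℝ E]
    {S : Set E} {x p : E} (hp : p ∈ Submodule.span ℝ S) (horth : ∀ y ∈ S, inner ℝ (x - p) y = 0) :
    Metric.infDist x (Submodule.span ℝ S : Set E) = Real.sqrt (inner ℝ (x - p) x) := by
  have hspan : ∀ y ∈ Submodule.span ℝ S, inner ℝ (x - p) y = 0 := by
    intro y hy
    induction hy using Submodule.span_induction with
    | mem y hy => exact horth y hy
    | zero => exact inner_zero_right _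
    | add y z _ _ hy hz => rw [inner_add_right, hy, hz, add_zero]
    | smul c y _ hy => rw [real_inner_smul_right, hy, mul_zero]
  have hnorm : inner ℝ (x - p) x = ‖x - p‖ ^ 2 := by
    rw [← real_inner_self_eq_norm_sq, inner_sub_right _ x p, hspan p hp, sub_zero]
  rw [hnorm, Real.sqrt_sq (norm_nonneg _)]
  refine le_antisymm ((Metric.infDist_le_dist_of_mem hp).trans_eq (dist_eq_norm x p)) ?_
  refine (Metric.le_infDist ⟨p, hp⟩).2 fun {y} hy => ?_
  have hpyth := norm_add_sq_eq_norm_sq_add_norm_sq_of_inner_eq_zero (x - p) (p - y)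
    (hspan _ (sub_mem hp hy))
  rw [sub_add_sub_cancel] at hpyth
  rw [dist_eq_norm]
  nlinarith [norm_nonneg (x - p), norm_nonneg (x - y), norm_nonneg (p - y)]

theorem inner_qfun_qfun {a b : ℝ} (ha : -5 ≤ a) (hab : a ≤ b) (hb : b ≤ 5) :
    inner ℝ (qfun a) (qfun b) = 5 - b := by
  unfold qfun
  rw [L2.real_inner_indicatorConstLp_one_indicatorConstLp_one]
  rw [measureReal_restrict_apply (measurableSet_Ioo.inter measurableSet_Ioo),
    Set.Ioo_inter_Ioo, Set.Ioo_inter_Ioo]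
  simp [max_eq_right hab, max_eq_left (ha.trans hab), hb]

/-- For `0 < t₁ < … < t_n ≤ 1` and `𝒰 = span{q_{t₁}, …, q_{t_n}} ⊂ L²((−5,5))`,
the `L²` distance of `q_t` to `𝒰` equals `√(t₁ − t)` for `t ∈ [0, t₁)` and
`√((t_{i+1} − t)(t − t_i)/(t_{i+1} − t_i))` for `t ∈ [t_i, t_{i+1}]`. -/
theorem advection_snapshot_space_distance
    (n : ℕ) (hn : 1 ≤ n) (t : Fin n → ℝ)
    (hmono : StrictMono t) (h0 : 0 < t ⟨0, hn⟩) (h1 : ∀ i, t i ≤ 1) :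
    (∀ tt : ℝ, 0 ≤ tt → tt < t ⟨0, hn⟩ →
      Metric.infDist (qfun tt)
          (Submodule.span ℝ (Set.range fun i : Fin n => qfun (t i)) :
            Set (Lp ℝ 2 ((volume : Measure ℝ).restrict (Set.Ioo (-5 : ℝ) 5)))) =
        Real.sqrt (t ⟨0, hn⟩ - tt)) ∧
    (∀ (i : Fin n) (hi : (i : ℕ) + 1 < n) (tt : ℝ),
      t i ≤ tt → tt ≤ t ⟨(i : ℕ) + 1, hi⟩ →
      Metric.infDist (qfun tt)
          (Submodule.span ℝ (Set.range fun i : Fin n => qfun (t i)) :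
            Set (Lp ℝ 2 ((volume : Measure ℝ).restrict (Set.Ioo (-5 : ℝ) 5)))) =
        Real.sqrt ((t ⟨(i : ℕ) + 1, hi⟩ - tt) * (tt - t i) /
          (t ⟨(i : ℕ) + 1, hi⟩ - t i))) := by
  have hfirst : ∀ j, t ⟨0, hn⟩ ≤ t j := fun j => hmono.monotone (Nat.zero_le j)
  have hpos : ∀ j, 0 < t j := fun j => h0.trans_le (hfirst j)
  have hmem : ∀ j, qfun (t j) ∈ Submodule.span ℝ (Set.range fun i : Fin n => qfun (t i)) :=
    fun j => Submodule.subset_span ⟨j, rfl⟩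
  refine ⟨fun s hs0 hs => ?_, fun i hi s hs1 hs2 => ?_⟩
  · rw [infDist_span_eq_sqrt_inner (hmem ⟨0, hn⟩)]
    · rw [inner_sub_left, real_inner_comm (qfun s) (qfun (t _)),
        inner_qfun_qfun (by linarith) le_rfl (by linarith [h1 ⟨0, hn⟩]),
        inner_qfun_qfun (by linarith) hs.le (by linarith [h1 ⟨0, hn⟩])]
      congr 1
      ring
    · rintro _ ⟨j, rfl⟩
      have hj := hfirst j
      rw [inner_sub_left, inner_qfun_qfun (by linarith) (by linarith) (by linarith [h1 j]),
        inner_qfun_qfun (by linarith) hj (by linarith [h1 j]), sub_self]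
  · set k : Fin n := ⟨(i : ℕ) + 1, hi⟩
    have hik : t i < t k := hmono (Nat.lt_succ_self i)
    have hi0 := hpos i
    have hk1 := h1 k
    have hd : t k - t i ≠ 0 := (sub_pos.2 hik).ne'
    rw [infDist_span_eq_sqrt_inner
      (p := ((t k - s) / (t k - t i)) • qfun (t i) + ((s - t i) / (t k - t i)) • qfun (t k))
      (add_mem (Submodule.smul_mem _ _ (hmem i))
        (Submodule.smul_mem _ _ (hmem k)))]
    · rw [inner_sub_left, inner_add_left, real_inner_smul_left, real_inner_smul_left,
        real_inner_comm (qfun s) (qfun (t k)),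
        inner_qfun_qfun (by linarith) le_rfl (by linarith),
        inner_qfun_qfun (by linarith) hs1 (by linarith),
        inner_qfun_qfun (by linarith) hs2 (by linarith)]
      congr 1
      field_simp
      ring
    · rintro _ ⟨j, rfl⟩
      have hj0 := hpos j
      have hj1 := h1 j
      dsimp only
      rw [inner_sub_left, inner_add_left, real_inner_smul_left, real_inner_smul_left]
      rcases le_or_gt j i with hji | hij
      · have hle : t j ≤ t i := hmono.monotone hji
        rw [real_inner_comm (qfun (t j)) (qfun s), real_inner_comm (qfun (t j)) (qfun (t i)),
          real_inner_comm (qfun (t j)) (qfun (t k)),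
          inner_qfun_qfun (by linarith) (by linarith) (by linarith),
          inner_qfun_qfun (by linarith) (by linarith) (by linarith),
          inner_qfun_qfun (by linarith) (by linarith) (by linarith)]
        field_simp
        ring
      · have hle : t k ≤ t j := hmono.monotone (Nat.succ_le_of_lt hij)
        rw [inner_qfun_qfun (by linarith) (by linarith) (by linarith),
          inner_qfun_qfun (by linarith) (by linarith) (by linarith),
          inner_qfun_qfun (by linarith) (by linarith) (by linarith)]
        field_simp
        ring
end

section
/- For s ∈ [0, 1], let q_s ∈ L²((−5, 5)) be the indicator function of (s, 5). Let T ∈ (0, 1] and n ≥ 1, set ζ = e^n and t_i = i·(T/(ζ·n)) for i = 1, …, n, and let 𝒰_n ⊂ L²((−5, 5)) be the linear span of q_{t_1}, …, q_{t_n}. Then sup_{t ∈ [0, T/ζ]} inf_{q* ∈ 𝒰_n} ‖q_t − q*‖_{L²(−5,5)} ≤ √(T/n) · e^{−n/2}; in particular, the worst-case approximation error of the n-dimensional spaces 𝒰_n on the shrinking time windows [0, T·e^{−n}] decays exponentially in n. -/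
open MeasureTheory

/-- The `L²` distance between two shifted step functions is at most the square root of the
shift. -/
lemma dist_qfun_le_sqrt {s t : ℝ} (hst : s ≤ t) :
    dist (qfun s) (qfun t) ≤ Real.sqrt (t - s) := by
  unfold qfun
  rw [dist_indicatorConstLp_eq_norm, norm_indicatorConstLp (by norm_num) (by norm_num),
    Real.sqrt_eq_rpow]
  simp only [norm_one, one_mul, ENNReal.toReal_ofNat]
  refine Real.rpow_le_rpow measureReal_nonneg ?_ (by norm_num)
  have hsub : symmDiff (Set.Ioo s 5) (Set.Ioo t 5) ⊆ Set.Ioc s t := by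
    rintro x (⟨⟨h1, h2⟩, h3⟩ | ⟨⟨h1, h2⟩, h3⟩)
    · exact ⟨h1, not_lt.mp fun h => h3 ⟨h, h2⟩⟩
    · exact (h3 ⟨hst.trans_lt h1, h2⟩).elim
  refine ENNReal.toReal_le_of_le_ofReal (sub_nonneg.mpr hst) ?_
  exact (Measure.restrict_apply_le _ _).trans ((measure_mono hsub).trans Real.volume_Ioc.le)

/-- Every point of `[0, n * h]` lies at most `h` to the left of one of the grid points
`h, 2 * h, …, n * h`. -/
lemma exists_grid_point_right {n : ℕ} (hn : 1 ≤ n) {h t : ℝ} (hh : 0 < h) (ht0 : 0 ≤ t)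
    (ht : t ≤ n * h) :
    ∃ i : Fin n, t ≤ (((i : ℕ) + 1 : ℕ) : ℝ) * h ∧ (((i : ℕ) + 1 : ℕ) : ℝ) * h - t ≤ h := by
  rcases ht0.eq_or_lt with rfl | htpos
  · exact ⟨⟨0, hn⟩, by simpa using hh.le, by simp⟩
  · have hm : 0 < ⌈t / h⌉₊ := Nat.ceil_pos.mpr (by positivity)
    have hmn : ⌈t / h⌉₊ ≤ n := Nat.ceil_le.mpr ((div_le_iff₀ hh).mpr ht)
    refine ⟨⟨⌈t / h⌉₊ - 1, by omega⟩, ?_⟩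
    simp only [Nat.sub_add_cancel hm]
    have h1 : t ≤ ⌈t / h⌉₊ * h := (div_le_iff₀ hh).mp (Nat.le_ceil _)
    have h2 : (⌈t / h⌉₊ : ℝ) * h < (t / h + 1) * h :=
      mul_lt_mul_of_pos_right (Nat.ceil_lt_add_one (by positivity)) hh
    rw [add_mul, div_mul_cancel₀ _ hh.ne', one_mul] at h2
    exact ⟨h1, by linarith⟩

/-- For `T ∈ (0, 1]`, `n ≥ 1`, `ζ = eⁿ`, `t_i = i·(T/(ζ·n))`, and
`𝒰_n = span{q_{t₁}, …, q_{t_n}} ⊂ L²((−5,5))`, the worst-case approximation error over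
the shrinking window `t ∈ [0, T/ζ]` satisfies
`sup_t inf_{q* ∈ 𝒰_n} ‖q_t − q*‖ ≤ √(T/n)·e^{−n/2}`, i.e. it decays exponentially
in `n`. -/
theorem advection_exponential_window_error_bound
    (T : ℝ) (hT1 : 0 < T) (hT2 : T ≤ 1) (n : ℕ) (hn : 1 ≤ n) :
    (⨆ tt : Set.Icc (0 : ℝ) (T / Real.exp n),
        Metric.infDist (qfun tt.1)
          (Submodule.span ℝ
              (Set.range fun i : Fin n =>
                qfun ((((i : ℕ) + 1 : ℕ) : ℝ) * (T / (Real.exp n * n)))) :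
            Set (Lp ℝ 2 ((volume : Measure ℝ).restrict (Set.Ioo (-5 : ℝ) 5))))) ≤
      Real.sqrt (T / n) * Real.exp (-(n : ℝ) / 2) := by
  have hn0 : (0 : ℝ) < n := by exact_mod_cast hn
  have hh : 0 < T / (Real.exp n * n) := by positivity
  have hnh : (n : ℝ) * (T / (Real.exp n * n)) = T / Real.exp n := by field_simp
  have hbound : Real.sqrt (T / (Real.exp n * n)) =
      Real.sqrt (T / n) * Real.exp (-(n : ℝ) / 2) := by
    rw [Real.exp_half, ← Real.sqrt_mul (by positivity), Real.exp_neg]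
    congr 1
    field_simp
  refine Real.iSup_le ?_ (by positivity)
  rintro ⟨t, ht0, ht⟩
  obtain ⟨i, hti, hit⟩ := exists_grid_point_right hn hh ht0 (ht.trans_eq hnh.symm)
  calc
    _ ≤ dist (qfun t) (qfun ((((i : ℕ) + 1 : ℕ) : ℝ) * (T / (Real.exp n * n)))) :=
      Metric.infDist_le_dist_of_mem (Submodule.subset_span (Set.mem_range_self i))
    _ ≤ Real.sqrt ((((i : ℕ) + 1 : ℕ) : ℝ) * (T / (Real.exp n * n)) - t) :=
      dist_qfun_le_sqrt hti
    _ ≤ Real.sqrt (T / (Real.exp n * n)) := Real.sqrt_le_sqrt hit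
    _ = _ := hbound
end
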